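/- Let 1 < γ < 3 and λ ≥ 0. Suppose the initial data (τ₀,u₀) ∈ C¹(ℝ) satisfy ‖u₀‖_{C¹} ≤ C₀, ‖τ₀‖_{C¹} ≤ C₀ and C₀⁻¹ < τ₀(x) for all x, for some constant C₀ > 0, and let (τ,u) be a C¹ solution of the system on ℝ × [0,∞). Then ‖u‖_{L∞} is uniformly bounded for all time, and there exists a constant C > 0 depending only on C₀, γ, K, λ and α such that the density ρ = τ⁻¹ satisfies ρ(x,t) ≥ C(1+t)^{4/(γ−3)} for all (x,t) ∈ ℝ × [0,∞); in particular, vacuum never occurs in finite time. -/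

import Mathlib

open Real Set MeasureTheory

/-- Partial derivative in the space variable `x`. -/
noncomputable def pdx (f : ℝ → ℝ → ℝ) (x t : ℝ) : ℝ := deriv (fun y => f y t) x

/-- Partial derivative in the time variable `t`. -/
noncomputable def pdt (f : ℝ → ℝ → ℝ) (x t : ℝ) : ℝ := deriv (fun s => f x s) t

/-- `(τ, u)` is a `C¹` solution of the compressible Euler equations with
time-dependent damping `τ_t - u_x = 0`, `u_t + p_x = -(α/(1+t)^λ) u`,
`p = K τ^{-γ}`, on `ℝ × [0,∞)`. -/
def IsSol (K γ α lam : ℝ) (τ u : ℝ → ℝ → ℝ) : Prop :=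
  ContDiff ℝ 1 (fun p : ℝ × ℝ => τ p.1 p.2) ∧
  ContDiff ℝ 1 (fun p : ℝ × ℝ => u p.1 p.2) ∧
  (∀ x t, 0 ≤ t → 0 < τ x t) ∧
  (∀ x t, 0 ≤ t → pdt τ x t = pdx u x t) ∧
  (∀ x t, 0 ≤ t →
    pdt u x t + pdx (fun y s => K * τ y s ^ (-γ)) x t = -(α / (1 + t) ^ lam) * u x t)

/-- `φ = (2√(Kγ)/(γ-1)) τ^{-(γ-1)/2}`. -/
noncomputable def Phi (K γ : ℝ) (τ : ℝ → ℝ → ℝ) (x t : ℝ) : ℝ :=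
  (2 * Real.sqrt (K * γ) / (γ - 1)) * τ x t ^ (-(γ - 1) / 2)

/-- `K_τ = (2√(Kγ)/(γ-1))^{2/(γ-1)}`. -/
noncomputable def Ktau (K γ : ℝ) : ℝ := (2 * Real.sqrt (K * γ) / (γ - 1)) ^ (2 / (γ - 1))

/-- `K_c = √(Kγ) K_τ^{-(γ+1)/2}`. -/
noncomputable def Kc (K γ : ℝ) : ℝ := Real.sqrt (K * γ) * Ktau K γ ^ (-(γ + 1) / 2)

/-- Blow-up of `‖(τ_x, u_x)‖_{L^∞}` in finite time. -/
def BlowsUp (τ u : ℝ → ℝ → ℝ) : Prop :=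
  ∃ T > (0 : ℝ),
    ¬ BddAbove {r : ℝ | ∃ x t, 0 ≤ t ∧ t ≤ T ∧ r = |pdx τ x t| + |pdx u x t|}

open Filter Topology

/-- Maximum principle along transversal directions in a backward light cone: if the continuous
functions `f i` are negative on the base of the cone, and the derivative of `f i` in the direction
`(v i, 1)` is negative with `|v i| ≤ N` whenever `f i` is the first to touch zero, then all `f i`
are negative at the apex. -/
lemma neg_at_apex_of_transport {ι : Type*} (S : Finset ι) (f v : ι → ℝ → ℝ → ℝ)
    {x₀ t₀ N : ℝ} (ht₀ : 0 ≤ t₀) (hN : 0 ≤ N)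
    (hf : ∀ i ∈ S, ContinuousOn (fun p : ℝ × ℝ => f i p.1 p.2) {p | 0 ≤ p.2})
    (h0 : ∀ i ∈ S, ∀ x, |x - x₀| ≤ N * t₀ → f i x 0 < 0)
    (hstep : ∀ i ∈ S, ∀ x t, 0 < t → t ≤ t₀ → |x - x₀| ≤ N * (t₀ - t) → f i x t = 0 →
      (∀ j ∈ S, f j x t ≤ 0) → |v i x t| ≤ N ∧
        ∃ d < 0, HasDerivAt (fun e => f i (x + e * v i x t) (t + e)) d 0) :
    ∀ i ∈ S, f i x₀ t₀ < 0 := by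
  intro k hk
  by_contra! hcon
  set T : Set (ℝ × ℝ) := {p | 0 ≤ p.2 ∧ p.2 ≤ t₀ ∧ |p.1 - x₀| ≤ N * (t₀ - p.2)} with hT
  have hTclosed : IsClosed T := by
    have h1 : IsClosed {p : ℝ × ℝ | 0 ≤ p.2} := isClosed_le (by fun_prop) (by fun_prop)
    have h2 : IsClosed {p : ℝ × ℝ | p.2 ≤ t₀} := isClosed_le (by fun_prop) (by fun_prop)
    have h3 : IsClosed {p : ℝ × ℝ | |p.1 - x₀| ≤ N * (t₀ - p.2)} :=
      isClosed_le (by fun_prop) (by fun_prop)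
    exact h1.inter (h2.inter h3)
  have hTcompact : IsCompact T := by
    refine (isCompact_Icc (a := x₀ - N * t₀) (b := x₀ + N * t₀)).prod
      (isCompact_Icc (a := (0 : ℝ)) (b := t₀)) |>.of_isClosed_subset hTclosed ?_
    rintro ⟨x, t⟩ ⟨h1, h2, h3⟩
    simp only at h1 h2 h3
    have h4 := abs_le.1 h3
    have h5 : 0 ≤ N * t := mul_nonneg hN h1
    refine ⟨⟨?_, ?_⟩, h1, h2⟩ <;> simp only <;> nlinarith
  have hTsub : T ⊆ {p | 0 ≤ p.2} := fun p hp => hp.1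
  set Z : Set (ℝ × ℝ) := ⋃ i ∈ S, T ∩ (fun p : ℝ × ℝ => f i p.1 p.2) ⁻¹' Set.Ici 0 with hZ
  have hZcompact : IsCompact Z := by
    refine S.finite_toSet.isCompact_biUnion fun i hi => ?_
    exact hTcompact.of_isClosed_subset
      (((hf i hi).mono hTsub).preimage_isClosed_of_isClosed hTclosed isClosed_Ici)
      Set.inter_subset_left
  have hZne : Z.Nonempty := by
    refine ⟨(x₀, t₀), Set.mem_biUnion hk ⟨⟨ht₀, le_rfl, by simp⟩, hcon⟩⟩
  obtain ⟨⟨x, t⟩, hPZ, hmin⟩ := hZcompact.exists_isMinOn hZne continuous_snd.continuousOn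
  obtain ⟨i, hi, hPT, hPi⟩ := Set.mem_iUnion₂.1 hPZ
  change 0 ≤ f i x t at hPi
  obtain ⟨ht, htt, hx⟩ := hPT
  simp only at ht htt hx
  have htpos : 0 < t := by
    rcases ht.lt_or_eq with h | h
    · exact h
    · subst h
      exact absurd (h0 i hi x (by simpa using hx)) (not_lt.2 hPi)
  have hearlier : ∀ j ∈ S, ∀ y s, (y, s) ∈ T → s < t → f j y s < 0 := by
    intro j hj y s hys hst
    by_contra! h
    have : (y, s) ∈ Z := Set.mem_biUnion hj ⟨hys, h⟩
    exact absurd (hmin this) (not_le.2 hst)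
  have hle : ∀ j ∈ S, f j x t ≤ 0 := by
    intro j hj
    have hc : Tendsto (fun s => f j x s) (𝓝[<] t) (𝓝 (f j x t)) := by
      have h1 : ContinuousAt (fun p : ℝ × ℝ => f j p.1 p.2) (x, t) :=
        (hf j hj).continuousAt (mem_of_superset
          ((isOpen_lt continuous_const continuous_snd).mem_nhds htpos)
          fun p (hp : 0 < p.2) => hp.le)
      have h2 : ContinuousAt (fun s : ℝ => (x, s)) t := by fun_prop
      exact (ContinuousAt.comp (f := fun s : ℝ => (x, s)) h1 h2).tendsto.mono_left
        nhdsWithin_le_nhds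
    refine le_of_tendsto hc ?_
    filter_upwards [Ioo_mem_nhdsLT htpos] with s hs
    refine (hearlier j hj x s ⟨hs.1.le, hs.2.le.trans htt, hx.trans ?_⟩ hs.2).le
    exact mul_le_mul_of_nonneg_left (by linarith [hs.2]) hN
  have hzero : f i x t = 0 := le_antisymm (hle i hi) hPi
  obtain ⟨hv, d, hd, hder⟩ := hstep i hi x t htpos htt hx hzero hle
  rw [hasDerivAt_iff_tendsto_slope_zero] at hder
  have hev : ∀ᶠ e in 𝓝[<] (0 : ℝ),
      e⁻¹ • (f i (x + (0 + e) * v i x t) (t + (0 + e)) - f i (x + 0 * v i x t) (t + 0)) < 0 :=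
    (hder.mono_left (nhdsWithin_mono _ fun e (he : e < 0) => he.ne)).eventually_lt_const hd
  obtain ⟨e, he, het⟩ := (hev.and (Ioo_mem_nhdsLT (show -t < (0 : ℝ) by linarith))).exists
  simp only [zero_add, zero_mul, add_zero, hzero, sub_zero, smul_eq_mul] at he
  have hneg : f i (x + e * v i x t) (t + e) < 0 := by
    refine hearlier i hi _ _ ⟨by simp only; linarith [het.1], by simp only; linarith [het.2], ?_⟩
      (by linarith [het.2])
    simp only
    calc |x + e * v i x t - x₀| = |(x - x₀) + e * v i x t| := by ring_nf
      _ ≤ |x - x₀| + |e * v i x t| := abs_add_le _ _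
      _ = |x - x₀| + (-e) * |v i x t| := by rw [abs_mul, abs_of_neg het.2]
      _ ≤ N * (t₀ - t) + (-e) * N := by
          gcongr
          linarith [het.2]
      _ = N * (t₀ - (t + e)) := by ring
  have := mul_pos_of_neg_of_neg (inv_lt_zero.2 het.2) hneg
  linarith

section C1

variable {f : ℝ → ℝ → ℝ}

lemma pdx_eq_fderiv (hf : ContDiff ℝ 1 (fun p : ℝ × ℝ => f p.1 p.2)) (x t : ℝ) :
    pdx f x t = fderiv ℝ (fun p : ℝ × ℝ => f p.1 p.2) (x, t) (1, 0) := by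
  have h := (hf.hasStrictFDerivAt (x := (x, t)) one_ne_zero).hasFDerivAt
  have h2 : HasDerivAt (fun y : ℝ => (y, t)) ((1 : ℝ), (0 : ℝ)) x :=
    (hasDerivAt_id x).prodMk (hasDerivAt_const x t)
  exact (h.comp_hasDerivAt x h2).deriv

lemma pdt_eq_fderiv (hf : ContDiff ℝ 1 (fun p : ℝ × ℝ => f p.1 p.2)) (x t : ℝ) :
    pdt f x t = fderiv ℝ (fun p : ℝ × ℝ => f p.1 p.2) (x, t) (0, 1) := by
  have h := (hf.hasStrictFDerivAt (x := (x, t)) one_ne_zero).hasFDerivAt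
  have h2 : HasDerivAt (fun s : ℝ => (x, s)) ((0 : ℝ), (1 : ℝ)) t :=
    (hasDerivAt_const t x).prodMk (hasDerivAt_id t)
  exact (h.comp_hasDerivAt t h2).deriv

lemma continuous_pdx (hf : ContDiff ℝ 1 (fun p : ℝ × ℝ => f p.1 p.2)) :
    Continuous (fun p : ℝ × ℝ => pdx f p.1 p.2) := by
  simp_rw [pdx_eq_fderiv hf]
  exact (hf.continuous_fderiv one_ne_zero).clm_apply continuous_const

lemma hasDerivAt_along (hf : ContDiff ℝ 1 (fun p : ℝ × ℝ => f p.1 p.2)) (x t v : ℝ) :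
    HasDerivAt (fun e => f (x + e * v) (t + e)) (v * pdx f x t + pdt f x t) 0 := by
  have h := (hf.hasStrictFDerivAt (x := (x, t)) one_ne_zero).hasFDerivAt
  have h2 : HasDerivAt (fun e : ℝ => (x + e * v, t + e)) ((v : ℝ), (1 : ℝ)) 0 := by
    refine HasDerivAt.prodMk ?_ ?_
    · simpa using ((hasDerivAt_id (0 : ℝ)).mul_const v).const_add x
    · simpa using (hasDerivAt_id (0 : ℝ)).const_add t
  have h3 := HasFDerivAt.comp_hasDerivAt (f := fun e : ℝ => (x + e * v, t + e)) (0 : ℝ)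
    (by simpa using h) h2
  refine h3.congr_deriv ?_
  rw [pdx_eq_fderiv hf, pdt_eq_fderiv hf, ← smul_eq_mul, ← map_smul, ← map_add]
  simp

lemma hasDerivAt_pdx (hf : ContDiff ℝ 1 (fun p : ℝ × ℝ => f p.1 p.2)) (x t : ℝ) :
    HasDerivAt (fun y => f y t) (pdx f x t) x := by
  have h : DifferentiableAt ℝ (fun y : ℝ => (fun p : ℝ × ℝ => f p.1 p.2) (y, t)) x :=
    ((hf.differentiable one_ne_zero).comp (by fun_prop)) x
  exact h.hasDerivAt

lemma hasDerivAt_pdt (hf : ContDiff ℝ 1 (fun p : ℝ × ℝ => f p.1 p.2)) (x t : ℝ) :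
    HasDerivAt (fun s => f x s) (pdt f x t) t := by
  have h : DifferentiableAt ℝ (fun s : ℝ => (fun p : ℝ × ℝ => f p.1 p.2) (x, s)) t :=
    ((hf.differentiable one_ne_zero).comp (by fun_prop)) t
  exact h.hasDerivAt

end C1

/-- The difference quotient of `f` with step `h` in the space variable. -/
noncomputable def spaceQuot (f : ℝ → ℝ → ℝ) (h x t : ℝ) : ℝ := (f (x + h) t - f x t) / h

/-- Strict differentiability makes the spatial difference quotients converge locally uniformly. -/
lemma tendsto_spaceQuot {f : ℝ → ℝ → ℝ} {L : ℝ × ℝ →L[ℝ] ℝ} {P : ℝ × ℝ}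
    (hf : HasStrictFDerivAt (fun p : ℝ × ℝ => f p.1 p.2) L P) :
    Tendsto (fun z : ℝ × (ℝ × ℝ) => spaceQuot f z.1 z.2.1 z.2.2)
      (𝓝[≠] 0 ×ˢ 𝓝 P) (𝓝 (L (1, 0))) := by
  have hid : Tendsto (fun z : ℝ × (ℝ × ℝ) => ((z.2.1 + z.1, z.2.2), z.2)) (𝓝[≠] 0 ×ˢ 𝓝 P)
      (𝓝 (P, P)) := by
    have hc : Continuous (fun z : ℝ × (ℝ × ℝ) => ((z.2.1 + z.1, z.2.2), z.2)) := by fun_prop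
    have := hc.tendsto ((0 : ℝ), P)
    rw [nhds_prod_eq] at this
    simp only [add_zero, Prod.mk.eta] at this
    exact this.mono_left (Filter.prod_mono nhdsWithin_le_nhds le_rfl)
  have ho := hf.isLittleO.comp_tendsto hid
  have hne : ∀ᶠ z : ℝ × (ℝ × ℝ) in 𝓝[≠] 0 ×ˢ 𝓝 P, z.1 ≠ 0 :=
    tendsto_fst.eventually self_mem_nhdsWithin
  have hO : ((fun p : (ℝ × ℝ) × (ℝ × ℝ) => p.1 - p.2) ∘
      fun z : ℝ × (ℝ × ℝ) => ((z.2.1 + z.1, z.2.2), z.2)) =O[𝓝[≠] 0 ×ˢ 𝓝 P] fun z => z.1 :=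
    Asymptotics.IsBigO.of_bound 1 (Eventually.of_forall fun z => by simp [Prod.norm_def])
  have ho2 := ho.trans_isBigO hO
  have h3 := ho2.tendsto_div_nhds_zero.add_const (L (1, 0))
  rw [zero_add] at h3
  refine h3.congr' ?_
  filter_upwards [hne] with z hz
  have hL : L (z.1, 0) = z.1 * L (1, 0) := by
    rw [← smul_eq_mul, ← map_smul]; simp
  simp only [Function.comp, spaceQuot]
  have : ((z.2.1 + z.1, z.2.2) : ℝ × ℝ) - z.2 = (z.1, 0) := by
    ext <;> simp
  rw [this, hL]
  field_simp
  ring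

/-- A pointwise locally uniform statement near a punctured parameter is uniform on compact sets. -/
lemma eventually_forall_of_isCompact {X : Type*} [TopologicalSpace X] {K : Set X}
    (hK : IsCompact K) {Q : ℝ → X → Prop}
    (hQ : ∀ P ∈ K, ∀ᶠ z : ℝ × X in 𝓝[≠] 0 ×ˢ 𝓝 P, Q z.1 z.2) :
    ∀ᶠ h in 𝓝[≠] (0 : ℝ), ∀ P ∈ K, Q h P := by
  have key : ∀ᶠ h in 𝓝 (0 : ℝ), ∀ P ∈ K, h ≠ 0 → Q h P := by
    refine hK.eventually_forall_of_forall_eventually fun P hP => ?_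
    obtain ⟨pa, ha, pb, hb, H⟩ := eventually_prod_iff.1 (hQ P hP)
    rw [nhds_prod_eq]
    filter_upwards [(eventually_nhdsWithin_iff.1 ha).prod_mk hb] with z hz hz0
    exact H (hz.1 hz0) hz.2
  rw [eventually_nhdsWithin_iff]
  filter_upwards [key] with h hh h0 P hP
  exact hh P hP h0

/-- The functions of the specific volume attached to a pressure law: `g` is the square root of the
sound speed, `φ` and `Θ` are antiderivatives of `-g²` and `g`. -/
structure SoundProfile (g dg φ Θ : ℝ → ℝ) : Prop where
  g_pos : ∀ s > 0, 0 < g s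
  hasStrictDerivAt_g : ∀ s > 0, HasStrictDerivAt g (dg s) s
  dg_nonpos : ∀ s > 0, dg s ≤ 0
  continuousAt_dg : ∀ s > 0, ContinuousAt dg s
  hasStrictDerivAt_φ : ∀ s > 0, HasStrictDerivAt φ (-(g s ^ 2)) s
  hasStrictDerivAt_Θ : ∀ s > 0, HasStrictDerivAt Θ (g s) s
  φ_nonneg : ∀ s > 0, 0 ≤ φ s
  Θ_nonneg : ∀ s > 0, 0 ≤ Θ s
  speed_bound : ∀ M, ∃ N ≥ 0, ∀ s > 0, φ s ≤ M → g s ^ 2 ≤ N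

/-- `(τ, u)` is a `C¹` solution of `τ_t = u_x`, `u_t = g(τ)⁴ τ_x - a u` for `t ≥ 0`, with a
bounded nonincreasing damping coefficient `a`. -/
structure DampedFlow (g a da : ℝ → ℝ) (α : ℝ) (τ u : ℝ → ℝ → ℝ) : Prop where
  contDiff_τ : ContDiff ℝ 1 (fun p : ℝ × ℝ => τ p.1 p.2)
  contDiff_u : ContDiff ℝ 1 (fun p : ℝ × ℝ => u p.1 p.2)
  τ_pos : ∀ x t, 0 ≤ t → 0 < τ x t
  mass : ∀ x t, 0 ≤ t → pdt τ x t = pdx u x t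
  momentum : ∀ x t, 0 ≤ t → pdt u x t = g (τ x t) ^ 4 * pdx τ x t - a t * u x t
  hasDerivAt_a : ∀ t, 0 ≤ t → HasDerivAt a (da t) t
  da_nonpos : ∀ t, 0 ≤ t → da t ≤ 0
  a_nonneg : ∀ t, 0 ≤ t → 0 ≤ a t
  a_le : ∀ t, 0 ≤ t → a t ≤ α

/-- The Riemann variable `u + σ φ(τ)`, for `σ = ± 1`. -/
def riemannVar (φ : ℝ → ℝ) (τ u : ℝ → ℝ → ℝ) (σ x t : ℝ) : ℝ := u x t + σ * φ (τ x t)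

/-- The space derivative of `riemannVar`. -/
noncomputable def riemannGrad (g : ℝ → ℝ) (τ u : ℝ → ℝ → ℝ) (σ x t : ℝ) : ℝ :=
  pdx u x t - σ * g (τ x t) ^ 2 * pdx τ x t

/-- The derivative along the `σ`-characteristic of `g(τ)` times the difference quotient with
step `h` of the Riemann variable. -/
noncomputable def quotTransport (g dg φ a : ℝ → ℝ) (τ u : ℝ → ℝ → ℝ) (σ h x t : ℝ) : ℝ :=
  dg (τ x t) * riemannGrad g τ u (-σ) x t * spaceQuot (riemannVar φ τ u σ) h x t +
    g (τ x t) * (-σ * spaceQuot (fun y s => g (τ y s) ^ 2) h x t * riemannGrad g τ u σ (x + h) t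
      - a t * spaceQuot u h x t)

/-- The limit of `quotTransport` as `h → 0`. -/
noncomputable def gradTransport (g dg a : ℝ → ℝ) (τ u : ℝ → ℝ → ℝ) (σ x t : ℝ) : ℝ :=
  dg (τ x t) * riemannGrad g τ u σ x t ^ 2 - a t * (g (τ x t) * pdx u x t)

namespace DampedFlow

variable {g dg φ Θ a da : ℝ → ℝ} {α : ℝ} {τ u : ℝ → ℝ → ℝ}

lemma hasStrictFDerivAt_comp (hs : DampedFlow g a da α τ u) {F : ℝ → ℝ} {dF x t : ℝ}
    (hF : HasStrictDerivAt F dF (τ x t)) :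
    ∃ L : ℝ × ℝ →L[ℝ] ℝ, L (1, 0) = dF * pdx τ x t ∧
      HasStrictFDerivAt (fun p : ℝ × ℝ => F (τ p.1 p.2)) L (x, t) := by
  have h := hs.contDiff_τ.hasStrictFDerivAt (x := (x, t)) one_ne_zero
  exact ⟨_, by simp [pdx_eq_fderiv hs.contDiff_τ], hF.comp_hasStrictFDerivAt (x, t) h⟩

lemma hasDerivAt_comp_along (hs : DampedFlow g a da α τ u) {F : ℝ → ℝ} {dF x t : ℝ} (v : ℝ)
    (ht : 0 ≤ t) (hF : HasDerivAt F dF (τ x t)) :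
    HasDerivAt (fun e => F (τ (x + e * v) (t + e))) (dF * (v * pdx τ x t + pdx u x t)) 0 := by
  have h := hasDerivAt_along hs.contDiff_τ x t v
  rw [hs.mass x t ht] at h
  exact HasDerivAt.comp (h := fun e => τ (x + e * v) (t + e)) 0 (by simpa using hF) h

lemma hasDerivAt_riemannVar_along (hs : DampedFlow g a da α τ u)
    (hp : SoundProfile g dg φ Θ) (σ v : ℝ) {x t : ℝ} (ht : 0 ≤ t) :
    HasDerivAt (fun e => riemannVar φ τ u σ (x + e * v) (t + e))
      (v * pdx u x t + (g (τ x t) ^ 4 * pdx τ x t - a t * u x t) +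
        σ * (-(g (τ x t) ^ 2) * (v * pdx τ x t + pdx u x t))) 0 := by
  have h1 := hasDerivAt_along hs.contDiff_u x t v
  rw [hs.momentum x t ht] at h1
  exact h1.add ((hs.hasDerivAt_comp_along v ht
    (hp.hasStrictDerivAt_φ _ (hs.τ_pos x t ht)).hasDerivAt).const_mul σ)

lemma continuousOn_comp (hs : DampedFlow g a da α τ u) {F : ℝ → ℝ}
    (hF : ∀ s > 0, ContinuousAt F s) (h : ℝ) :
    ContinuousOn (fun p : ℝ × ℝ => F (τ (p.1 + h) p.2)) {p | 0 ≤ p.2} := by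
  intro p hp
  have hc : Continuous (fun p : ℝ × ℝ => τ (p.1 + h) p.2) :=
    hs.contDiff_τ.continuous.comp (f := fun p : ℝ × ℝ => (p.1 + h, p.2)) (by fun_prop)
  exact (ContinuousAt.comp (f := fun p : ℝ × ℝ => τ (p.1 + h) p.2)
    (hF _ (hs.τ_pos _ _ hp)) hc.continuousAt).continuousWithinAt

lemma continuousOn_riemannVar (hs : DampedFlow g a da α τ u) (hp : SoundProfile g dg φ Θ)
    (σ h : ℝ) :
    ContinuousOn (fun p : ℝ × ℝ => riemannVar φ τ u σ (p.1 + h) p.2) {p | 0 ≤ p.2} := by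
  have hc : Continuous (fun p : ℝ × ℝ => u (p.1 + h) p.2) :=
    hs.contDiff_u.continuous.comp (f := fun p : ℝ × ℝ => (p.1 + h, p.2)) (by fun_prop)
  exact hc.continuousOn.add (continuousOn_const.mul (hs.continuousOn_comp
    (fun s h0 => (hp.hasStrictDerivAt_φ s h0).hasDerivAt.continuousAt) h))

lemma continuousOn_damping (hs : DampedFlow g a da α τ u) :
    ContinuousOn (fun p : ℝ × ℝ => a p.2) {p | 0 ≤ p.2} := fun p hp =>
  (ContinuousAt.comp (f := fun p : ℝ × ℝ => p.2) (hs.hasDerivAt_a p.2 hp).continuousAt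
    continuous_snd.continuousAt).continuousWithinAt

/-- The invariant region of the Riemann variables. -/
theorem riemannVar_le (hs : DampedFlow g a da α τ u) (hp : SoundProfile g dg φ Θ) {M : ℝ}
    (h0 : ∀ x, |u x 0| + φ (τ x 0) ≤ M) {x₀ t₀ : ℝ} (ht₀ : 0 ≤ t₀) :
    |u x₀ t₀| + φ (τ x₀ t₀) ≤ M := by
  have key : ∀ ε > 0, ∀ σ ∈ ({1, -1} : Finset ℝ),
      σ * riemannVar φ τ u σ x₀ t₀ - (M + ε * (1 + t₀)) < 0 := by
    intro ε hε
    obtain ⟨N, hN, hspeed⟩ := hp.speed_bound (M + ε * (1 + t₀))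
    refine neg_at_apex_of_transport {1, -1}
      (fun σ x t => σ * riemannVar φ τ u σ x t - (M + ε * (1 + t)))
      (fun σ x t => σ * g (τ x t) ^ 2) ht₀ hN ?_ ?_ ?_
    · intro σ _
      have := hs.continuousOn_riemannVar hp σ 0
      simp only [add_zero] at this
      exact (continuousOn_const.mul this).sub (by fun_prop)
    · intro σ hσ x _
      have hu := abs_le.1 (le_refl |u x 0|)
      have := h0 x
      simp only [Finset.mem_insert, Finset.mem_singleton] at hσ
      rcases hσ with rfl | rfl <;> simp only [riemannVar] <;> linarith
    · intro σ hσ x t ht htt _ hzero hle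
      have hσ2 : σ ^ 2 = 1 := by
        simp only [Finset.mem_insert, Finset.mem_singleton] at hσ
        rcases hσ with rfl | rfl <;> norm_num
      have hother := hle (-σ) (by
        simp only [Finset.mem_insert, Finset.mem_singleton] at hσ ⊢
        rcases hσ with rfl | rfl <;> simp)
      simp only [riemannVar] at hzero hother
      have hsu : 0 ≤ σ * u x t := by linear_combination (1 / 2) * hother + (-1 / 2) * hzero
      have hφ : φ (τ x t) ≤ M + ε * (1 + t) := by
        linear_combination (1 / 2) * hother + (1 / 2) * hzero - φ (τ x t) * hσ2
      have hφ' : φ (τ x t) ≤ M + ε * (1 + t₀) := hφ.trans (by gcongr)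
      have habs : |σ| = 1 := by
        simp only [Finset.mem_insert, Finset.mem_singleton] at hσ
        rcases hσ with rfl | rfl <;> simp
      refine ⟨?_, _, ?_, ((hs.hasDerivAt_riemannVar_along hp σ _ ht.le).const_mul σ).sub
        ((((hasDerivAt_id (0 : ℝ)).const_add t).const_add 1 |>.const_mul ε).const_add M)⟩
      · rw [abs_mul, habs, one_mul, abs_of_nonneg (sq_nonneg _)]
        exact hspeed _ (hs.τ_pos x t ht.le) hφ'
      · have := mul_nonneg (hs.a_nonneg t ht.le) hsu
        linear_combination this + hε +
          (-(σ * pdx τ x t * g (τ x t) ^ 4)) * hσ2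
  have h1 : ∀ σ ∈ ({1, -1} : Finset ℝ), σ * riemannVar φ τ u σ x₀ t₀ ≤ M := by
    intro σ hσ
    refine le_of_forall_pos_le_add fun ε hε => ?_
    have := key (ε / (1 + t₀)) (by positivity) σ hσ
    rw [div_mul_cancel₀ _ (by positivity)] at this
    linarith
  have h2 := h1 1 (by simp)
  have h3 := h1 (-1) (by simp)
  simp only [riemannVar] at h2 h3
  rcases abs_cases (u x₀ t₀) with h | h <;> linarith [h.1]

lemma continuousAt_comp (hs : DampedFlow g a da α τ u) {F : ℝ → ℝ}
    (hF : ∀ s > 0, ContinuousAt F s) {x t : ℝ} (ht : 0 ≤ t) :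
    ContinuousAt (fun p : ℝ × ℝ => F (τ p.1 p.2)) (x, t) :=
  ContinuousAt.comp (f := fun p : ℝ × ℝ => τ p.1 p.2) (hF _ (hs.τ_pos _ _ ht))
    hs.contDiff_τ.continuous.continuousAt

lemma continuousAt_riemannGrad (hs : DampedFlow g a da α τ u) (hp : SoundProfile g dg φ Θ)
    (σ : ℝ) {x t : ℝ} (ht : 0 ≤ t) :
    ContinuousAt (fun p : ℝ × ℝ => riemannGrad g τ u σ p.1 p.2) (x, t) := by
  have hg := hs.continuousAt_comp (x := x)
    (fun s h0 => (hp.hasStrictDerivAt_g s h0).hasDerivAt.continuousAt) ht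
  exact (continuous_pdx hs.contDiff_u).continuousAt.sub
    ((continuousAt_const.mul (hg.pow 2)).mul (continuous_pdx hs.contDiff_τ).continuousAt)

lemma tendsto_spaceQuot_riemannVar (hs : DampedFlow g a da α τ u) (hp : SoundProfile g dg φ Θ)
    (σ : ℝ) {x t : ℝ} (ht : 0 ≤ t) :
    Tendsto (fun z : ℝ × (ℝ × ℝ) => spaceQuot (riemannVar φ τ u σ) z.1 z.2.1 z.2.2)
      (𝓝[≠] 0 ×ˢ 𝓝 (x, t)) (𝓝 (riemannGrad g τ u σ x t)) := by
  obtain ⟨L, hL, hφ⟩ := hs.hasStrictFDerivAt_comp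
    (hp.hasStrictDerivAt_φ _ (hs.τ_pos x t ht))
  have hu := hs.contDiff_u.hasStrictFDerivAt (x := (x, t)) one_ne_zero
  have := tendsto_spaceQuot (f := riemannVar φ τ u σ) (hu.add (hφ.const_mul σ))
  convert this using 2
  simp only [_root_.add_apply, _root_.smul_apply, hL,
    ← pdx_eq_fderiv hs.contDiff_u, riemannGrad, smul_eq_mul]
  ring

lemma tendsto_quot_sub_grad (hs : DampedFlow g a da α τ u) (hp : SoundProfile g dg φ Θ)
    (σ : ℝ) {x t : ℝ} (ht : 0 ≤ t) :
    Tendsto (fun z : ℝ × (ℝ × ℝ) =>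
      g (τ z.2.1 z.2.2) * spaceQuot (riemannVar φ τ u σ) z.1 z.2.1 z.2.2 -
        g (τ z.2.1 z.2.2) * riemannGrad g τ u σ z.2.1 z.2.2)
      (𝓝[≠] 0 ×ˢ 𝓝 (x, t)) (𝓝 0) := by
  have hg := (hs.continuousAt_comp (x := x)
    (fun s h0 => (hp.hasStrictDerivAt_g s h0).hasDerivAt.continuousAt) ht).tendsto.comp
    (tendsto_snd (f := 𝓝[≠] (0 : ℝ)))
  have hW := (hs.continuousAt_riemannGrad hp σ (x := x) ht).tendsto.comp
    (tendsto_snd (f := 𝓝[≠] (0 : ℝ)))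
  have := (hg.mul (hs.tendsto_spaceQuot_riemannVar hp σ (x := x) ht)).sub (hg.mul hW)
  rw [sub_self] at this
  exact this

lemma tendsto_quotTransport_sub (hs : DampedFlow g a da α τ u) (hp : SoundProfile g dg φ Θ)
    (σ : ℝ) {x t : ℝ} (ht : 0 ≤ t) :
    Tendsto (fun z : ℝ × (ℝ × ℝ) =>
      quotTransport g dg φ a τ u σ z.1 z.2.1 z.2.2 - gradTransport g dg a τ u σ z.2.1 z.2.2)
      (𝓝[≠] 0 ×ˢ 𝓝 (x, t)) (𝓝 0) := by
  have lift : ∀ {F : ℝ × ℝ → ℝ}, ContinuousAt F (x, t) →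
      Tendsto (fun z : ℝ × (ℝ × ℝ) => F z.2) (𝓝[≠] 0 ×ˢ 𝓝 (x, t)) (𝓝 (F (x, t))) :=
    fun hF => hF.tendsto.comp tendsto_snd
  have hτ := hs.τ_pos x t ht
  have hg := lift (hs.continuousAt_comp (x := x)
    (fun s h0 => (hp.hasStrictDerivAt_g s h0).hasDerivAt.continuousAt) ht)
  have hdg := lift (hs.continuousAt_comp (x := x) hp.continuousAt_dg ht)
  have ha := lift (F := fun p => a p.2)
    (ContinuousAt.comp (f := fun p : ℝ × ℝ => p.2) (hs.hasDerivAt_a t ht).continuousAt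
      continuous_snd.continuousAt)
  have hux := lift (continuous_pdx hs.contDiff_u).continuousAt
  have hW := lift (hs.continuousAt_riemannGrad hp σ (x := x) ht)
  have hW' := lift (hs.continuousAt_riemannGrad hp (-σ) (x := x) ht)
  have hDW := hs.tendsto_spaceQuot_riemannVar hp σ (x := x) ht
  have hDu := tendsto_spaceQuot (hs.contDiff_u.hasStrictFDerivAt (x := (x, t)) one_ne_zero)
  rw [← pdx_eq_fderiv hs.contDiff_u] at hDu
  obtain ⟨L, hL, hc⟩ := hs.hasStrictFDerivAt_comp (x := x) (t := t)
    ((hp.hasStrictDerivAt_g _ hτ).pow 2)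
  have hDc := tendsto_spaceQuot (f := fun y s => g (τ y s) ^ 2) hc
  rw [hL] at hDc
  have hshift : Tendsto (fun z : ℝ × (ℝ × ℝ) => (z.2.1 + z.1, z.2.2))
      (𝓝[≠] 0 ×ˢ 𝓝 (x, t)) (𝓝 (x, t)) := by
    have hcont : Continuous (fun z : ℝ × (ℝ × ℝ) => (z.2.1 + z.1, z.2.2)) := by fun_prop
    have := hcont.tendsto ((0 : ℝ), (x, t))
    rw [nhds_prod_eq] at this
    simp only [add_zero] at this
    exact this.mono_left (Filter.prod_mono nhdsWithin_le_nhds le_rfl)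
  have hWh := (hs.continuousAt_riemannGrad hp σ (x := x) ht).tendsto.comp hshift
  have := (((hdg.mul hW').mul hDW).add
    (hg.mul (((tendsto_const_nhds (x := -σ)).mul hDc |>.mul hWh).sub (ha.mul hDu)))).sub
    ((hdg.mul (hW.pow 2)).sub (ha.mul (hg.mul hux)))
  refine (this.congr fun _ => rfl).trans (le_of_eq ?_)
  congr 1
  simp only [riemannGrad, Nat.cast_ofNat, Nat.add_one_sub_one, pow_one]
  ring

lemma hasDerivAt_quot_along (hs : DampedFlow g a da α τ u) (hp : SoundProfile g dg φ Θ)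
    {σ : ℝ} (hσ : σ ^ 2 = 1) (h : ℝ) {x t : ℝ} (ht : 0 ≤ t) :
    HasDerivAt (fun e => g (τ (x + e * (σ * g (τ x t) ^ 2)) (t + e)) *
        spaceQuot (riemannVar φ τ u σ) h (x + e * (σ * g (τ x t) ^ 2)) (t + e))
      (quotTransport g dg φ a τ u σ h x t) 0 := by
  set v := σ * g (τ x t) ^ 2 with hv
  have h1 := hs.hasDerivAt_comp_along v ht (hp.hasStrictDerivAt_g _ (hs.τ_pos x t ht)).hasDerivAt
  have h2 := hs.hasDerivAt_riemannVar_along hp σ v (x := x) ht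
  have h3 := hs.hasDerivAt_riemannVar_along hp σ v (x := x + h) ht
  simp_rw [show ∀ e, x + h + e * v = x + e * v + h from fun e => by ring] at h3
  refine (h1.mul ((h3.sub h2).div_const h)).congr_deriv ?_
  simp only [zero_mul, add_zero, quotTransport, riemannGrad, spaceQuot, hv, Pi.sub_apply]
  linear_combination (g (τ x t) / h * (g (τ x t) ^ 4 * pdx τ x t - g (τ (x + h) t) ^ 4 *
    pdx τ (x + h) t)) * hσ

lemma hasDerivAt_damping_along (hs : DampedFlow g a da α τ u) (hp : SoundProfile g dg φ Θ)
    (v : ℝ) {x t : ℝ} (ht : 0 ≤ t) :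
    HasDerivAt (fun e => a (t + e) / 2 * Θ (τ (x + e * v) (t + e)))
      (da t / 2 * Θ (τ x t) + a t / 2 * (g (τ x t) * (v * pdx τ x t + pdx u x t))) 0 := by
  have h1 : HasDerivAt (fun e => a (t + e)) (da t) 0 :=
    HasDerivAt.comp_const_add t 0 (by simpa using hs.hasDerivAt_a t ht)
  have h2 := hs.hasDerivAt_comp_along (x := x) v ht
    (hp.hasStrictDerivAt_Θ _ (hs.τ_pos x t ht)).hasDerivAt
  refine ((h1.div_const 2).mul h2).congr_deriv ?_
  simp

lemma exists_step (hs : DampedFlow g a da α τ u) (hp : SoundProfile g dg φ Θ) {K : Set (ℝ × ℝ)}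
    (hK : IsCompact K) (hKt : ∀ p ∈ K, 0 ≤ p.2) {η : ℝ} (hη : 0 < η) :
    ∃ h, ∀ p ∈ K, ∀ σ ∈ ({1, -1} : Finset ℝ),
      |g (τ p.1 p.2) * spaceQuot (riemannVar φ τ u σ) h p.1 p.2 -
        g (τ p.1 p.2) * riemannGrad g τ u σ p.1 p.2| < η ∧
      quotTransport g dg φ a τ u σ h p.1 p.2 < gradTransport g dg a τ u σ p.1 p.2 + η := by
  have key : ∀ σ : ℝ, ∀ᶠ h in 𝓝[≠] (0 : ℝ), ∀ p ∈ K,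
      |g (τ p.1 p.2) * spaceQuot (riemannVar φ τ u σ) h p.1 p.2 -
        g (τ p.1 p.2) * riemannGrad g τ u σ p.1 p.2| < η ∧
      quotTransport g dg φ a τ u σ h p.1 p.2 < gradTransport g dg a τ u σ p.1 p.2 + η := by
    intro σ
    refine eventually_forall_of_isCompact hK fun P hP => ?_
    have h1 := (hs.tendsto_quot_sub_grad hp σ (x := P.1) (hKt P hP)).abs
    rw [abs_zero] at h1
    filter_upwards [h1.eventually_lt_const hη,
      (hs.tendsto_quotTransport_sub hp σ (x := P.1) (hKt P hP)).eventually_lt_const hη]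
      with z hz1 hz2
    exact ⟨hz1, by linarith⟩
  obtain ⟨h, h1, h2⟩ := ((key 1).and (key (-1))).exists
  refine ⟨h, fun p hpK σ hσ => ?_⟩
  simp only [Finset.mem_insert, Finset.mem_singleton] at hσ
  rcases hσ with rfl | rfl
  exacts [h1 p hpK, h2 p hpK]

/-- One-sided bound of the weighted gradients of the Riemann variables. -/
theorem weighted_grad_le (hs : DampedFlow g a da α τ u) (hp : SoundProfile g dg φ Θ) {N Y : ℝ}
    (hspeed : ∀ x t, 0 ≤ t → g (τ x t) ^ 2 ≤ N)
    (h0 : ∀ x, ∀ σ ∈ ({1, -1} : Finset ℝ),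
      g (τ x 0) * riemannGrad g τ u σ x 0 + a 0 / 2 * Θ (τ x 0) ≤ Y)
    (h0Θ : ∀ x, a 0 / 2 * Θ (τ x 0) ≤ Y) {x₀ t₀ : ℝ} (ht₀ : 0 ≤ t₀) {σ₀ : ℝ}
    (hσ₀ : σ₀ ∈ ({1, -1} : Finset ℝ)) :
    g (τ x₀ t₀) * riemannGrad g τ u σ₀ x₀ t₀ + a t₀ / 2 * Θ (τ x₀ t₀) ≤ Y := by
  have hN : 0 ≤ N := (sq_nonneg _).trans (hspeed 0 0 le_rfl)
  have hα : 0 ≤ α := (hs.a_nonneg 0 le_rfl).trans (hs.a_le 0 le_rfl)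
  have key : ∀ δ > 0, g (τ x₀ t₀) * riemannGrad g τ u σ₀ x₀ t₀ + a t₀ / 2 * Θ (τ x₀ t₀) ≤
      Y + δ * (1 + t₀) + δ := by
    intro δ hδ
    set η := δ / (2 + α) with hηdef
    have hη : 0 < η := by positivity
    have hηδ : η * (2 + α) = δ := div_mul_cancel₀ _ (by positivity)
    have hηα : 0 ≤ η * α := by positivity
    set K : Set (ℝ × ℝ) := Set.Icc (x₀ - N * t₀) (x₀ + N * t₀) ×ˢ Set.Icc 0 t₀
    have hK : IsCompact K := isCompact_Icc.prod isCompact_Icc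
    obtain ⟨h, hh⟩ := hs.exists_step hp hK (fun p hpK => hpK.2.1) hη
    have hmemK : ∀ {x t : ℝ}, 0 ≤ t → t ≤ t₀ → |x - x₀| ≤ N * (t₀ - t) → (x, t) ∈ K := by
      intro x t ht htt hx
      have h4 := abs_le.1 hx
      have h5 : 0 ≤ N * t := mul_nonneg hN ht
      refine ⟨⟨?_, ?_⟩, ht, htt⟩ <;> simp only <;> nlinarith
    have hneg := neg_at_apex_of_transport {1, -1, 0}
      (fun σ x t => σ ^ 2 * (g (τ x t) * spaceQuot (riemannVar φ τ u σ) h x t) +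
        a t / 2 * Θ (τ x t) - (Y + δ * (1 + t)))
      (fun σ x t => σ * g (τ x t) ^ 2) (x₀ := x₀) ht₀ hN ?_ ?_ ?_
    · have h1 := hneg σ₀ (by
        simp only [Finset.mem_insert, Finset.mem_singleton] at hσ₀ ⊢
        tauto)
      have h2 := abs_lt.1 (hh (x₀, t₀) (hmemK ht₀ le_rfl (by simp)) σ₀ hσ₀).1
      have hσ2 : σ₀ ^ 2 = 1 := by
        simp only [Finset.mem_insert, Finset.mem_singleton] at hσ₀
        rcases hσ₀ with rfl | rfl <;> norm_num
      simp only [hσ2, one_mul] at h1 h2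
      linarith [h2.1]
    · intro σ _
      have hg := hs.continuousOn_comp
        (fun s h0 => (hp.hasStrictDerivAt_g s h0).hasDerivAt.continuousAt) 0
      have hΘ := hs.continuousOn_comp
        (fun s h0 => (hp.hasStrictDerivAt_Θ s h0).hasDerivAt.continuousAt) 0
      have hW := hs.continuousOn_riemannVar hp σ 0
      have hWh := hs.continuousOn_riemannVar hp σ h
      simp only [add_zero] at hg hΘ hW
      exact ((continuousOn_const.mul (hg.mul ((hWh.sub hW).div_const h))).add
        ((hs.continuousOn_damping.div_const 2).mul hΘ)).sub (by fun_prop)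
    · intro σ hσ x hx
      have hxK : (x, (0 : ℝ)) ∈ K := hmemK le_rfl ht₀ (by simpa using hx)
      have hσ' : σ ∈ ({1, -1} : Finset ℝ) ∨ σ = 0 := by
        simp only [Finset.mem_insert, Finset.mem_singleton] at hσ ⊢
        tauto
      rcases hσ' with hσ' | rfl
      · have hσ2 : σ ^ 2 = 1 := by
          simp only [Finset.mem_insert, Finset.mem_singleton] at hσ'
          rcases hσ' with rfl | rfl <;> norm_num
        have h2 := abs_lt.1 (hh (x, 0) hxK σ hσ').1
        have h3 := h0 x σ hσ'
        simp only [hσ2, one_mul] at h2 ⊢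
        linarith [h2.2]
      · have := h0Θ x
        norm_num
        linarith
    · intro σ hσ x t ht htt hx hzero hle
      have hxK : (x, t) ∈ K := hmemK ht.le htt hx
      have hτ := hs.τ_pos x t ht.le
      have hΘ := hp.Θ_nonneg _ hτ
      have hg := hp.g_pos _ hτ
      have hat := hs.a_nonneg t ht.le
      have haα := hs.a_le t ht.le
      have haη : a t * η ≤ η * α := by nlinarith
      have hdaΘ := mul_nonpos_of_nonpos_of_nonneg (hs.da_nonpos t ht.le) hΘ
      have hbar : HasDerivAt (fun e : ℝ => Y + δ * (1 + (t + e))) δ 0 := by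
        simpa using (((hasDerivAt_id (0 : ℝ)).const_add t).const_add 1 |>.const_mul δ).const_add Y
      have hσ' : σ ∈ ({1, -1} : Finset ℝ) ∨ σ = 0 := by
        simp only [Finset.mem_insert, Finset.mem_singleton] at hσ ⊢
        tauto
      rcases hσ' with hσ' | rfl
      · have hσ2 : σ ^ 2 = 1 := by
          simp only [Finset.mem_insert, Finset.mem_singleton] at hσ'
          rcases hσ' with rfl | rfl <;> norm_num
        have habs : |σ| = 1 := by
          simp only [Finset.mem_insert, Finset.mem_singleton] at hσ'
          rcases hσ' with rfl | rfl <;> simp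
        refine ⟨?_, _, ?_, (((hs.hasDerivAt_quot_along hp hσ2 h ht.le).const_mul (σ ^ 2)).add
          (hs.hasDerivAt_damping_along hp _ ht.le)).sub hbar⟩
        · rw [abs_mul, habs, one_mul, abs_of_nonneg (sq_nonneg _)]
          exact hspeed x t ht.le
        · obtain ⟨h2, h3⟩ := hh (x, t) hxK σ hσ'
          have h2 := abs_lt.1 h2
          have h4 := hle 0 (by simp)
          have hdg := mul_nonpos_of_nonpos_of_nonneg (hp.dg_nonpos _ hτ)
            (sq_nonneg (riemannGrad g τ u σ x t))
          simp only [hσ2, one_mul, ne_eq, OfNat.ofNat_ne_zero, not_false_eq_true, zero_pow,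
            zero_mul, zero_add, gradTransport] at h2 h3 h4 hzero ⊢
          have hy : -η ≤ g (τ x t) * riemannGrad g τ u σ x t := by linarith [h2.2]
          have hay := mul_le_mul_of_nonneg_left hy hat
          have hid : a t / 2 * (g (τ x t) * (σ * g (τ x t) ^ 2 * pdx τ x t + pdx u x t)) -
              a t * (g (τ x t) * pdx u x t) =
              -(a t * (g (τ x t) * riemannGrad g τ u σ x t)) / 2 := by
            simp only [riemannGrad]; ring
          linarith
      · refine ⟨by simpa using hN, da t / 2 * Θ (τ x t) + a t / 2 * (g (τ x t) * pdx u x t) - δ,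
          ?_, ?_⟩
        · have h1 := hle 1 (by simp)
          have h2 := hle (-1) (by simp)
          have h3 := abs_lt.1 (hh (x, t) hxK 1 (by simp)).1
          have h4 := abs_lt.1 (hh (x, t) hxK (-1) (by simp)).1
          norm_num at h1 h2 hzero
          have hid : g (τ x t) * pdx u x t = (g (τ x t) * riemannGrad g τ u 1 x t +
              g (τ x t) * riemannGrad g τ u (-1) x t) / 2 := by
            simp only [riemannGrad]; ring
          have hux : g (τ x t) * pdx u x t ≤ η := by
            simp only at h3 h4
            linarith [h3.1, h4.1]
          have hau := mul_le_mul_of_nonneg_left hux hat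
          linarith
        · refine HasDerivAt.sub ?_ hbar
          simpa using hs.hasDerivAt_damping_along hp 0 (x := x) ht.le
  refine le_of_forall_pos_le_add fun ε hε => ?_
  have := key (ε / (2 + t₀)) (by positivity)
  have h2 : ε / (2 + t₀) * (1 + t₀) + ε / (2 + t₀) = ε := by field_simp; ring
  linarith

/-- The function `Θ(τ)` grows at most linearly in time. -/
theorem Θ_le (hs : DampedFlow g a da α τ u) (hp : SoundProfile g dg φ Θ) {N Y : ℝ}
    (hspeed : ∀ x t, 0 ≤ t → g (τ x t) ^ 2 ≤ N)
    (h0 : ∀ x, ∀ σ ∈ ({1, -1} : Finset ℝ),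
      g (τ x 0) * riemannGrad g τ u σ x 0 + a 0 / 2 * Θ (τ x 0) ≤ Y)
    (h0Θ : ∀ x, a 0 / 2 * Θ (τ x 0) ≤ Y) {x t : ℝ} (ht : 0 ≤ t) :
    Θ (τ x t) ≤ Θ (τ x 0) + Y * t := by
  have hder : ∀ s, 0 ≤ s → HasDerivAt (fun s => Θ (τ x s) - Y * s)
      (g (τ x s) * pdx u x s - Y) s := by
    intro s h
    have h1 := hasDerivAt_pdt hs.contDiff_τ x s
    rw [hs.mass x s h] at h1
    refine (HasDerivAt.comp (h := fun s => τ x s) s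
      (hp.hasStrictDerivAt_Θ _ (hs.τ_pos x s h)).hasDerivAt h1).sub ?_
    simpa using (hasDerivAt_id s).const_mul Y
  have hanti : AntitoneOn (fun s => Θ (τ x s) - Y * s) (Set.Ici 0) := by
    refine antitoneOn_of_hasDerivWithinAt_nonpos (convex_Ici 0)
      (fun s h => (hder s h).continuousAt.continuousWithinAt)
      (fun s h => (hder s (interior_subset h)).hasDerivWithinAt) fun s h => ?_
    have hs0 : (0 : ℝ) ≤ s := interior_subset (s := Set.Ici (0 : ℝ)) h
    have h1 := hs.weighted_grad_le hp hspeed h0 h0Θ (x₀ := x) hs0 (σ₀ := 1) (by simp)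
    have h2 := hs.weighted_grad_le hp hspeed h0 h0Θ (x₀ := x) hs0 (σ₀ := -1) (by simp)
    have h3 := mul_nonneg (hs.a_nonneg s hs0) (hp.Θ_nonneg _ (hs.τ_pos x s hs0))
    simp only [riemannGrad] at h1 h2
    linarith
  have := hanti (Set.mem_Ici.2 le_rfl) (Set.mem_Ici.2 ht) ht
  simp only [mul_zero, sub_zero] at this
  linarith

end DampedFlow

/-- The profile of a power law: the square root of the sound speed is `κ s^{-β}`. -/
lemma soundProfile_rpow {κ β : ℝ} (hκ : 0 < κ) (hβ : 1 / 2 < β) (hβ1 : β < 1) :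
    SoundProfile (fun s => κ * s ^ (-β)) (fun s => κ * (-β * s ^ (-β - 1)))
      (fun s => κ ^ 2 / (2 * β - 1) * s ^ (1 - 2 * β))
      (fun s => κ / (1 - β) * s ^ (1 - β)) where
  g_pos s hs := by positivity
  hasStrictDerivAt_g s hs :=
    (Real.hasStrictDerivAt_rpow_const (Or.inl hs.ne')).const_mul κ
  dg_nonpos s hs := by
    have : 0 < s ^ (-β - 1) := by positivity
    have h2 : 0 < κ * (β * s ^ (-β - 1)) := by positivity
    linarith
  continuousAt_dg s hs := continuousAt_const.mul
    (continuousAt_const.mul (Real.continuousAt_rpow_const _ _ (Or.inl hs.ne')))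
  hasStrictDerivAt_φ s hs := by
    refine ((Real.hasStrictDerivAt_rpow_const (p := 1 - 2 * β) (Or.inl hs.ne')).const_mul
      (κ ^ 2 / (2 * β - 1))).congr_deriv ?_
    have h1 : (s ^ (-β)) ^ 2 = s ^ (1 - 2 * β - 1) := by
      rw [← Real.rpow_natCast, ← Real.rpow_mul hs.le]; congr 1; push_cast; ring
    have h2 : 2 * β - 1 ≠ 0 := by linarith
    rw [mul_pow, h1]
    field_simp
    ring
  hasStrictDerivAt_Θ s hs := by
    refine ((Real.hasStrictDerivAt_rpow_const (p := 1 - β) (Or.inl hs.ne')).const_mul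
      (κ / (1 - β))).congr_deriv ?_
    have h2 : 1 - β ≠ 0 := by linarith
    rw [show 1 - β - 1 = -β by ring]
    field_simp
  φ_nonneg s hs := by
    have : 0 < 2 * β - 1 := by linarith
    positivity
  Θ_nonneg s hs := by
    have : 0 < 1 - β := by linarith
    positivity
  speed_bound M := by
    have hb : 0 < 2 * β - 1 := by linarith
    refine ⟨κ ^ 2 * |M * (2 * β - 1) / κ ^ 2| ^ (2 * β / (2 * β - 1)), by positivity,
      fun s hs hM => ?_⟩
    have h1 : s ^ (1 - 2 * β) ≤ |M * (2 * β - 1) / κ ^ 2| := by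
      refine le_trans ?_ (le_abs_self _)
      rw [le_div_iff₀ (by positivity)]
      rw [div_mul_eq_mul_div, div_le_iff₀ hb] at hM
      linarith
    have h2 : (s ^ (-β)) ^ 2 = (s ^ (1 - 2 * β)) ^ (2 * β / (2 * β - 1)) := by
      rw [← Real.rpow_natCast, ← Real.rpow_mul hs.le, ← Real.rpow_mul hs.le]
      congr 1
      rw [mul_div_assoc', eq_div_iff hb.ne']
      push_cast
      ring
    rw [mul_pow, h2]
    gcongr

/-- Solutions of the damped Euler equations in terms of the square root of the sound speed. -/
lemma IsSol.dampedFlow {K γ α lam κ : ℝ} {τ u : ℝ → ℝ → ℝ} (hκ : κ ^ 4 = K * γ) (hα : 0 ≤ α)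
    (hlam : 0 ≤ lam) (h : IsSol K γ α lam τ u) :
    DampedFlow (fun s => κ * s ^ (-((γ + 1) / 4))) (fun t => α / (1 + t) ^ lam)
      (fun t => -(α * (lam * (1 + t) ^ (lam - 1))) / ((1 + t) ^ lam) ^ 2) α τ u where
  contDiff_τ := h.1
  contDiff_u := h.2.1
  τ_pos := h.2.2.1
  mass := h.2.2.2.1
  momentum x t ht := by
    have hτ := h.2.2.1 x t ht
    have hp : pdx (fun y s => K * τ y s ^ (-γ)) x t =
        K * (pdx τ x t * -γ * τ x t ^ (-γ - 1)) :=
      (((hasDerivAt_pdx h.1 x t).rpow_const (Or.inl hτ.ne')).const_mul K).deriv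
    have h4 : (τ x t ^ (-((γ + 1) / 4))) ^ 4 = τ x t ^ (-γ - 1) := by
      rw [← Real.rpow_natCast, ← Real.rpow_mul hτ.le]; congr 1; push_cast; ring
    have := h.2.2.2.2 x t ht
    rw [hp] at this
    rw [mul_pow, h4, hκ]
    linarith
  hasDerivAt_a t ht := by
    have h1 : HasDerivAt (fun t : ℝ => (1 + t) ^ lam) (lam * (1 + t) ^ (lam - 1)) t := by
      simpa using ((hasDerivAt_id t).const_add 1).rpow_const (p := lam)
        (Or.inl (by simp only [id]; positivity))
    exact ((hasDerivAt_const t α).div h1 (by positivity)).congr_deriv (by rw [zero_mul, zero_sub])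
  da_nonpos t ht := by
    have : 0 ≤ α * (lam * (1 + t) ^ (lam - 1)) := by positivity
    exact div_nonpos_of_nonpos_of_nonneg (by linarith) (by positivity)
  a_nonneg t ht := by positivity
  a_le t ht := div_le_self hα (Real.one_le_rpow (by linarith) hlam)

theorem stmt2 (K γ α lam C₀ : ℝ) (hK : 0 < K) (hγ1 : 1 < γ) (hγ3 : γ < 3)
    (hα : 0 ≤ α) (hlam : 0 ≤ lam) (hC₀ : 0 < C₀) :
    ∃ C > (0 : ℝ),
      ∀ (τ₀ u₀ : ℝ → ℝ), ContDiff ℝ 1 τ₀ → ContDiff ℝ 1 u₀ →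
        (∀ x, |u₀ x| ≤ C₀ ∧ |deriv u₀ x| ≤ C₀) →
        (∀ x, |τ₀ x| ≤ C₀ ∧ |deriv τ₀ x| ≤ C₀) →
        (∀ x, C₀⁻¹ < τ₀ x) →
      ∀ (τ u : ℝ → ℝ → ℝ), IsSol K γ α lam τ u →
        (∀ x, τ x 0 = τ₀ x ∧ u x 0 = u₀ x) →
        (∃ U : ℝ, ∀ x t, 0 ≤ t → |u x t| ≤ U) ∧
        (∀ x t, 0 ≤ t → C * (1 + t) ^ ((4 : ℝ) / (γ - 3)) ≤ (τ x t)⁻¹) := by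
  set κ : ℝ := (K * γ) ^ (1 / 4 : ℝ) with hκdef
  have hκ : 0 < κ := by positivity
  have hκ4 : κ ^ 4 = K * γ := by
    rw [hκdef, ← Real.rpow_natCast, ← Real.rpow_mul (by positivity)]
    norm_num
  set β : ℝ := (γ + 1) / 4 with hβ
  have hβ1 : 0 < 1 - β := by linarith
  have hp := soundProfile_rpow hκ (β := β) (by linarith) (by linarith)
  set g : ℝ → ℝ := fun s => κ * s ^ (-β) with hg
  set φ : ℝ → ℝ := fun s => κ ^ 2 / (2 * β - 1) * s ^ (1 - 2 * β) with hφ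
  set Θ : ℝ → ℝ := fun s => κ / (1 - β) * s ^ (1 - β) with hΘ
  have hi : 0 < C₀⁻¹ := by positivity
  set G : ℝ := g C₀⁻¹
  have hG : 0 < G := hp.g_pos _ hi
  have hΘC : 0 < Θ C₀ := by simp only [hΘ]; positivity
  set Y : ℝ := G * (C₀ + G ^ 2 * C₀) + α / 2 * Θ C₀ with hY
  have hYpos : 0 < Y := by positivity
  set B : ℝ := (Θ C₀ + Y) * (1 - β) / κ with hB
  have hBpos : 0 < B := by positivity
  refine ⟨B ^ ((4 : ℝ) / (γ - 3)), by positivity, ?_⟩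
  intro τ₀ u₀ _ _ hu₀ hτ₀ hτ₀' τ u hsol hinit
  have hs := hsol.dampedFlow hκ4 hα hlam
  have hτ0 : (fun y => τ y 0) = τ₀ := funext fun y => (hinit y).1
  have hu0 : (fun y => u y 0) = u₀ := funext fun y => (hinit y).2
  have hM : ∀ x, |u x 0| + φ (τ x 0) ≤ C₀ + φ C₀⁻¹ := by
    intro x
    rw [(hinit x).1, (hinit x).2]
    have hb : 0 < 2 * β - 1 := by linarith
    refine add_le_add (hu₀ x).1 (mul_le_mul_of_nonneg_left ?_ (by positivity))
    exact Real.rpow_le_rpow_of_nonpos hi (hτ₀' x).le (by linarith)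
  have hbound : ∀ x t, 0 ≤ t → |u x t| + φ (τ x t) ≤ C₀ + φ C₀⁻¹ :=
    fun x t ht => hs.riemannVar_le hp hM ht
  refine ⟨⟨C₀ + φ C₀⁻¹, fun x t ht => ?_⟩, fun x t ht => ?_⟩
  · linarith [hbound x t ht, hp.φ_nonneg _ (hs.τ_pos x t ht)]
  obtain ⟨N, _, hN⟩ := hp.speed_bound (C₀ + φ C₀⁻¹)
  have hspeed : ∀ x t, 0 ≤ t → g (τ x t) ^ 2 ≤ N := fun x t ht =>
    hN _ (hs.τ_pos x t ht) (by linarith [hbound x t ht, abs_nonneg (u x t)])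
  have hΘ0 : ∀ x, Θ (τ x 0) ≤ Θ C₀ := by
    intro x
    refine mul_le_mul_of_nonneg_left ?_ (by positivity)
    refine Real.rpow_le_rpow (hs.τ_pos x 0 le_rfl).le ?_ hβ1.le
    rw [(hinit x).1]
    exact (le_abs_self _).trans (hτ₀ x).1
  have hg0 : ∀ x, g (τ x 0) ≤ G := by
    intro x
    refine mul_le_mul_of_nonneg_left ?_ hκ.le
    rw [(hinit x).1]
    exact Real.rpow_le_rpow_of_nonpos hi (hτ₀' x).le (by linarith)
  have ha0 : ∀ x, α / (1 + 0) ^ lam / 2 * Θ (τ x 0) ≤ α / 2 * Θ C₀ := by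
    intro x
    rw [add_zero, Real.one_rpow, div_one]
    exact mul_le_mul_of_nonneg_left (hΘ0 x) (by positivity)
  have hgrad : ∀ x, ∀ σ ∈ ({1, -1} : Finset ℝ),
      g (τ x 0) * riemannGrad g τ u σ x 0 + α / (1 + 0) ^ lam / 2 * Θ (τ x 0) ≤ Y := by
    intro x σ hσ
    refine add_le_add ?_ (ha0 x)
    have hgp := hp.g_pos _ (hs.τ_pos x 0 le_rfl)
    have h1 : |pdx u x 0| ≤ C₀ := by simpa only [pdx, hu0] using (hu₀ x).2
    have h2 : |pdx τ x 0| ≤ C₀ := by simpa only [pdx, hτ0] using (hτ₀ x).2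
    have habs : |σ| = 1 := by
      simp only [Finset.mem_insert, Finset.mem_singleton] at hσ
      rcases hσ with rfl | rfl <;> simp
    have h3 : riemannGrad g τ u σ x 0 ≤ C₀ + G ^ 2 * C₀ := by
      calc riemannGrad g τ u σ x 0 ≤ |pdx u x 0| + |σ * g (τ x 0) ^ 2 * pdx τ x 0| :=
            (le_abs_self _).trans (abs_sub _ _)
        _ = |pdx u x 0| + g (τ x 0) ^ 2 * |pdx τ x 0| := by
            rw [abs_mul, abs_mul, habs, one_mul, abs_of_nonneg (sq_nonneg (g (τ x 0)))]
        _ ≤ C₀ + G ^ 2 * C₀ := by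
            gcongr
            exact hg0 x
    exact (mul_le_mul_of_nonneg_left h3 hgp.le).trans
      (mul_le_mul_of_nonneg_right (hg0 x) (by positivity))
  have hgrowth := hs.Θ_le hp hspeed hgrad
    (fun x => (ha0 x).trans (le_add_of_nonneg_left (by positivity))) (x := x) ht
  have hτ := hs.τ_pos x t ht
  have hpow : τ x t ^ (1 - β) ≤ B * (1 + t) := by
    have h1 : κ / (1 - β) * τ x t ^ (1 - β) ≤ (Θ C₀ + Y) * (1 + t) := by
      have := mul_nonneg hΘC.le ht
      have h2 := hΘ0 x
      calc κ / (1 - β) * τ x t ^ (1 - β) ≤ Θ (τ x 0) + Y * t := hgrowth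
        _ ≤ (Θ C₀ + Y) * (1 + t) := by linarith
    rw [hB, div_mul_eq_mul_div, le_div_iff₀ hκ]
    rw [div_mul_eq_mul_div, div_le_iff₀ hβ1] at h1
    linarith
  have hγ : γ - 3 ≠ 0 := by linarith
  calc B ^ ((4 : ℝ) / (γ - 3)) * (1 + t) ^ ((4 : ℝ) / (γ - 3))
      = (B * (1 + t)) ^ ((4 : ℝ) / (γ - 3)) :=
        (Real.mul_rpow hBpos.le (by linarith)).symm
    _ ≤ (τ x t ^ (1 - β)) ^ ((4 : ℝ) / (γ - 3)) :=
        Real.rpow_le_rpow_of_nonpos (by positivity) hpow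
          (div_nonpos_of_nonneg_of_nonpos (by norm_num) (by linarith))
    _ = (τ x t)⁻¹ := by
        rw [← Real.rpow_mul hτ.le, ← Real.rpow_neg_one]
        congr 1
        rw [hβ]
        field_simp
        ring
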